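/- Let H be a real Hilbert space, V : H →L[ℝ] H a compact, self-adjoint, positive continuous linear operator, β ∈ H, and α ∈ (0,1). Suppose w* ∈ H is a unit vector with T_α(w*) > 0 such that T_α(w) < T_α(w*) for every unit vector w with w ≠ w* and w ≠ −w*. Then for every δ > 0 there exists ε > 0 such that T_α(w) ≤ T_α(w*) − ε for every w ∈ H with ‖w‖ ≤ 1, ‖w − w*‖ ≥ δ, and ‖w + w*‖ ≥ δ. (The well-separated-maximum property used in the proof of the paper's Theorem 1.) -/

import Mathlib

open RealInnerProductSpace Filter

/-- The continuum criterion `T_α(w) = ⟪β, V w⟫² ⋅ ⟪w, V w⟫^{α/(1-α) - 1}` when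
`⟪w, V w⟫ > 0`, and `0` otherwise. -/
noncomputable def Tcrit {H : Type*} [NormedAddCommGroup H] [InnerProductSpace ℝ H]
    (V : H →L[ℝ] H) (β : H) (α : ℝ) (w : H) : ℝ :=
  if 0 < ⟪w, V w⟫ then ⟪β, V w⟫ ^ 2 * ⟪w, V w⟫ ^ (α / (1 - α) - 1) else 0

open Topology

section

variable {H : Type*} [NormedAddCommGroup H] [InnerProductSpace ℝ H]

/-- Cauchy–Schwarz for the semi-inner product `⟪x, V y⟫`. -/
lemma inner_apply_sq_le_of_symmetric_of_nonneg {V : H →L[ℝ] H}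
    (hsa : ∀ x y : H, ⟪V x, y⟫ = ⟪x, V y⟫) (hpos : ∀ x : H, 0 ≤ ⟪x, V x⟫) (x y : H) :
    ⟪x, V y⟫ ^ 2 ≤ ⟪x, V x⟫ * ⟪y, V y⟫ := by
  have hquad : ∀ t : ℝ, 0 ≤ ⟪x, V x⟫ * (t * t) + (2 * ⟪x, V y⟫) * t + ⟪y, V y⟫ := by
    intro t
    have h := hpos (t • x + y)
    have hxy : ⟪y, V x⟫ = ⟪x, V y⟫ := by rw [← hsa, real_inner_comm]
    simp only [map_add, map_smul, inner_add_left, inner_add_right, real_inner_smul_left,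
      real_inner_smul_right, hxy] at h
    linarith
  have h := discrim_le_zero hquad
  rw [discrim] at h
  linarith

/-- The unit ball of a Hilbert space is weakly compact, in terms of ultrafilters. -/
lemma exists_tendsto_inner_of_norm_le_one [CompleteSpace H] {ι : Type*} (l : Ultrafilter ι)
    {u : ι → H} (hu : ∀ i, ‖u i‖ ≤ 1) :
    ∃ w : H, ‖w‖ ≤ 1 ∧ ∀ x : H, Tendsto (fun i => ⟪u i, x⟫) l (𝓝 ⟪w, x⟫) := by
  let f : ι → WeakDual ℝ H := fun i => StrongDual.toWeakDual (InnerProductSpace.toDual ℝ H (u i))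
  have hcomp := WeakDual.isCompact_closedBall (𝕜 := ℝ) (E := H) 0 1
  obtain ⟨φ, hφ, hlim⟩ := hcomp.ultrafilter_le_nhds (l.map f) (by
    rw [le_principal_iff]
    refine Filter.mem_map.2 (univ_mem' fun i => ?_)
    simpa [f] using hu i)
  refine ⟨(InnerProductSpace.toDual ℝ H).symm (WeakDual.toStrongDual φ), ?_, fun x => ?_⟩
  · simpa using hφ
  · have h : Tendsto (fun i => f i x) l (𝓝 (φ x)) :=
      (WeakDual.eval_continuous x).continuousAt.tendsto.comp hlim
    simpa [f] using h

/-- A compact symmetric operator maps weakly convergent bounded ultrafilters to convergent ones. -/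
lemma IsCompactOperator.tendsto_of_tendsto_inner {V : H →L[ℝ] H} (hcpt : IsCompactOperator V)
    (hsa : ∀ x y : H, ⟪V x, y⟫ = ⟪x, V y⟫) {ι : Type*} {l : Ultrafilter ι} {u : ι → H}
    (hu : ∀ i, ‖u i‖ ≤ 1) {w : H} (hw : ∀ x : H, Tendsto (fun i => ⟪u i, x⟫) l (𝓝 ⟪w, x⟫)) :
    Tendsto (fun i => V (u i)) l (𝓝 (V w)) := by
  obtain ⟨K, hK, hVK⟩ := hcpt.image_closedBall_subset_compact (f := (V : H →ₗ[ℝ] H)) 1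
  obtain ⟨y, -, hy⟩ := hK.ultrafilter_le_nhds (l.map fun i => V (u i)) (by
    rw [le_principal_iff]
    exact Filter.mem_map.2 (univ_mem' fun i => hVK ⟨u i, by simpa using hu i, rfl⟩))
  have hy' : Tendsto (fun i => V (u i)) l (𝓝 y) := hy
  suffices y = V w from this ▸ hy'
  refine ext_inner_right ℝ fun x => tendsto_nhds_unique (hy'.inner tendsto_const_nhds) ?_
  simpa only [hsa] using hw (V x)

lemma div_one_sub_sub_one_add_one_pos {α : ℝ} (hα : α ∈ Set.Ioo (0 : ℝ) 1) :
    0 < α / (1 - α) - 1 + 1 := by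
  have := div_pos hα.1 (sub_pos.2 hα.2)
  linarith

lemma Tcrit_neg (V : H →L[ℝ] H) (β : H) (α : ℝ) (w : H) :
    Tcrit V β α (-w) = Tcrit V β α w := by
  simp [Tcrit]

lemma Tcrit_smul (V : H →L[ℝ] H) (β : H) (α : ℝ) {c : ℝ} (hc : 0 < c) (w : H) :
    Tcrit V β α (c • w) = (c ^ 2) ^ (α / (1 - α) - 1 + 1) * Tcrit V β α w := by
  have hc2 : 0 < c ^ 2 := by positivity
  have hq : ⟪c • w, V (c • w)⟫ = c ^ 2 * ⟪w, V w⟫ := by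
    rw [map_smul, real_inner_smul_left, real_inner_smul_right]
    ring
  unfold Tcrit
  rw [hq]
  by_cases h : 0 < ⟪w, V w⟫
  · rw [if_pos h, if_pos (mul_pos hc2 h), Real.mul_rpow hc2.le h.le, Real.rpow_add_one hc2.ne',
      map_smul, real_inner_smul_right]
    ring
  · rw [if_neg h, if_neg (by rwa [mul_pos_iff_of_pos_left hc2]), mul_zero]

lemma Tcrit_nonneg (V : H →L[ℝ] H) (β : H) (α : ℝ) (w : H) : 0 ≤ Tcrit V β α w := by
  unfold Tcrit
  split_ifs <;> positivity

lemma Tcrit_le {V : H →L[ℝ] H} (hsa : ∀ x y : H, ⟪V x, y⟫ = ⟪x, V y⟫)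
    (hpos : ∀ x : H, 0 ≤ ⟪x, V x⟫) (β : H) (α : ℝ) (w : H) :
    Tcrit V β α w ≤ ⟪β, V β⟫ * ⟪w, V w⟫ ^ (α / (1 - α) - 1 + 1) := by
  unfold Tcrit
  split_ifs with h
  · rw [Real.rpow_add_one h.ne', mul_left_comm, mul_comm]
    exact mul_le_mul_of_nonneg_left (inner_apply_sq_le_of_symmetric_of_nonneg hsa hpos β w)
      (Real.rpow_nonneg h.le _)
  · exact mul_nonneg (hpos β) (Real.rpow_nonneg (hpos w) _)

lemma tendsto_Tcrit {V : H →L[ℝ] H} (hsa : ∀ x y : H, ⟪V x, y⟫ = ⟪x, V y⟫)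
    (hpos : ∀ x : H, 0 ≤ ⟪x, V x⟫) (β : H) {α : ℝ} (hα : α ∈ Set.Ioo (0 : ℝ) 1)
    {ι : Type*} {l : Filter ι} {u : ι → H} {w : H}
    (hV : Tendsto (fun i => V (u i)) l (𝓝 (V w)))
    (hq : Tendsto (fun i => ⟪u i, V (u i)⟫) l (𝓝 ⟪w, V w⟫)) :
    Tendsto (fun i => Tcrit V β α (u i)) l (𝓝 (Tcrit V β α w)) := by
  rcases (hpos w).lt_or_eq with h | h
  · have hT : Tendsto (fun i => ⟪β, V (u i)⟫ ^ 2 * ⟪u i, V (u i)⟫ ^ (α / (1 - α) - 1)) l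
        (𝓝 (Tcrit V β α w)) := by
      rw [Tcrit, if_pos h]
      exact ((tendsto_const_nhds.inner hV).pow 2).mul (hq.rpow_const (Or.inl h.ne'))
    refine hT.congr' ?_
    filter_upwards [hq.eventually (lt_mem_nhds h)] with i hi
    rw [Tcrit, if_pos hi]
  · have hν := div_one_sub_sub_one_add_one_pos hα
    have hT : Tcrit V β α w = 0 := if_neg h.not_lt
    rw [hT]
    refine squeeze_zero (fun i => Tcrit_nonneg V β α (u i))
      (fun i => Tcrit_le hsa hpos β α (u i)) ?_
    have hlim := (hq.rpow_const (Or.inr hν.le)).const_mul ⟪β, V β⟫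
    rwa [← h, Real.zero_rpow hν.ne', mul_zero] at hlim

/-- If `u` stays in the unit ball and converges weakly to a unit vector, it gets close to it. -/
lemma not_forall_le_norm_sub_of_tendsto_inner {ι : Type*} {l : Filter ι} [l.NeBot] {u : ι → H}
    (hu : ∀ i, ‖u i‖ ≤ 1) {w : H} (hw : ‖w‖ = 1)
    (hlim : Tendsto (fun i => ⟪u i, w⟫) l (𝓝 ⟪w, w⟫)) {δ : ℝ} (hδ : 0 < δ) :
    ¬ ∀ i, δ ≤ ‖u i - w‖ := by
  intro h
  have hle : ∀ i, δ ^ 2 ≤ 2 - 2 * ⟪u i, w⟫ := by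
    intro i
    have h1 : δ ^ 2 ≤ ‖u i - w‖ ^ 2 := pow_le_pow_left₀ hδ.le (h i) 2
    have h2 : ‖u i‖ ^ 2 ≤ 1 := pow_le_one₀ (norm_nonneg _) (hu i)
    rw [norm_sub_sq_real, hw] at h1
    linarith
  have := ge_of_tendsto' ((hlim.const_mul 2).const_sub 2) hle
  rw [real_inner_self_eq_norm_sq, hw] at this
  have := pow_pos hδ 2
  linarith

/-- A maximizer on the unit sphere that is unique up to sign is also, up to sign, the only vector
of the unit ball that reaches the maximal value. -/
lemma eq_or_eq_neg_of_le_Tcrit {V : H →L[ℝ] H} {β : H} {α : ℝ} (hα : α ∈ Set.Ioo (0 : ℝ) 1)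
    {wstar : H} (hTpos : 0 < Tcrit V β α wstar)
    (huniq : ∀ w : H, ‖w‖ = 1 → w ≠ wstar → w ≠ -wstar →
      Tcrit V β α w < Tcrit V β α wstar)
    {w : H} (hw : ‖w‖ ≤ 1) (hT : Tcrit V β α wstar ≤ Tcrit V β α w) :
    w = wstar ∨ w = -wstar := by
  have hν := div_one_sub_sub_one_add_one_pos hα
  have hw0 : w ≠ 0 := by
    rintro rfl
    simp [Tcrit] at hT hTpos
    linarith
  have hn : 0 < ‖w‖ := norm_pos_iff.2 hw0
  set v : H := ‖w‖⁻¹ • w with hv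
  have hv1 : ‖v‖ = 1 := by
    rw [hv, norm_smul, norm_inv, norm_norm, inv_mul_cancel₀ hn.ne']
  have hwv : w = ‖w‖ • v := by rw [hv, smul_inv_smul₀ hn.ne']
  have hTw : Tcrit V β α w = (‖w‖ ^ 2) ^ (α / (1 - α) - 1 + 1) * Tcrit V β α v := by
    conv_lhs => rw [hwv]
    exact Tcrit_smul V β α hn v
  have hfac : (‖w‖ ^ 2) ^ (α / (1 - α) - 1 + 1) ≤ 1 :=
    Real.rpow_le_one (by positivity) (pow_le_one₀ hn.le hw) hν.le
  have hle : Tcrit V β α wstar ≤ Tcrit V β α v :=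
    hT.trans (hTw.trans_le (mul_le_of_le_one_left (Tcrit_nonneg V β α v) hfac))
  have hvs : v = wstar ∨ v = -wstar := by
    by_contra! h
    exact (huniq v hv1 h.1 h.2).not_ge hle
  have hTv : Tcrit V β α v = Tcrit V β α wstar := by
    rcases hvs with h | h <;> rw [h]
    exact Tcrit_neg V β α wstar
  have hnorm : ‖w‖ = 1 := by
    refine hw.antisymm ?_
    by_contra! hlt
    have hfac' : (‖w‖ ^ 2) ^ (α / (1 - α) - 1 + 1) < 1 :=
      Real.rpow_lt_one (by positivity) (pow_lt_one₀ hn.le hlt two_ne_zero) hν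
    rw [hTw, hTv] at hT
    exact (mul_lt_of_lt_one_left hTpos hfac').not_ge hT
  rwa [hwv, hnorm, one_smul]

end

/-- The well-separated-maximum property used in the proof of Theorem 1. -/
theorem continuum_criterion_well_separated_max
    {H : Type*} [NormedAddCommGroup H] [InnerProductSpace ℝ H] [CompleteSpace H]
    (V : H →L[ℝ] H) (hcpt : IsCompactOperator V)
    (hsa : ∀ x y : H, ⟪V x, y⟫ = ⟪x, V y⟫)
    (hpos : ∀ x : H, 0 ≤ ⟪x, V x⟫)
    (β : H) (α : ℝ) (hα : α ∈ Set.Ioo (0 : ℝ) 1)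
    (wstar : H) (hnorm : ‖wstar‖ = 1)
    (hTpos : 0 < Tcrit V β α wstar)
    (huniq : ∀ w : H, ‖w‖ = 1 → w ≠ wstar → w ≠ -wstar →
      Tcrit V β α w < Tcrit V β α wstar) :
    ∀ δ > (0 : ℝ), ∃ ε > (0 : ℝ), ∀ w : H, ‖w‖ ≤ 1 →
      δ ≤ ‖w - wstar‖ → δ ≤ ‖w + wstar‖ →
      Tcrit V β α w ≤ Tcrit V β α wstar - ε := by
  intro δ hδ
  by_contra! hcon
  choose! u hu1 hu2 hu3 hu4 using fun n : ℕ =>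
    hcon (1 / ((n : ℝ) + 1)) Nat.one_div_pos_of_nat
  let l : Ultrafilter ℕ := hyperfilter ℕ
  have hl : (l : Filter ℕ) ≤ atTop := Nat.hyperfilter_le_atTop
  obtain ⟨w, hw1, hw⟩ := exists_tendsto_inner_of_norm_le_one l hu1
  have hV := hcpt.tendsto_of_tendsto_inner hsa hu1 hw
  have hq : Tendsto (fun n => ⟪u n, V (u n)⟫) l (𝓝 ⟪w, V w⟫) := by
    have hdiff : Tendsto (fun n => ⟪u n, V (u n) - V w⟫) l (𝓝 0) := by
      refine squeeze_zero_norm (fun n => ?_) (tendsto_iff_norm_sub_tendsto_zero.1 hV)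
      exact (norm_inner_le_norm _ _).trans (mul_le_of_le_one_left (norm_nonneg _) (hu1 n))
    simpa [inner_sub_right] using hdiff.add (hw (V w))
  have hlow : Tendsto (fun n : ℕ => Tcrit V β α wstar - 1 / ((n : ℝ) + 1)) l
      (𝓝 (Tcrit V β α wstar)) := by
    simpa using (tendsto_one_div_add_atTop_nhds_zero_nat.mono_left hl).const_sub
      (Tcrit V β α wstar)
  have hT : Tcrit V β α wstar ≤ Tcrit V β α w :=
    le_of_tendsto_of_tendsto' hlow (tendsto_Tcrit hsa hpos β hα hV hq) fun n => (hu4 n).le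
  rcases eq_or_eq_neg_of_le_Tcrit hα hTpos huniq hw1 hT with rfl | rfl
  · exact not_forall_le_norm_sub_of_tendsto_inner hu1 hnorm (hw _) hδ hu2
  · exact not_forall_le_norm_sub_of_tendsto_inner hu1 (by rwa [norm_neg]) (hw _) hδ
      (by simpa only [sub_neg_eq_add] using hu3)
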